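/- arXiv:2404.18070 — 7 statements merged into one kernel-verified Lean document; each statement's English description precedes it below -/
import Mathlib

section
/- For every real number ν there exists a constant C(ν) > 0 such that for all y ≥ 1, ∫_0^∞ e^{−y·cosh t − ν t} dt ≤ C(ν) · e^{−y}/√y. -/
theorem Real.one_add_sq_div_two_le_cosh_of_nonneg {t : ℝ} (ht : 0 ≤ t) :
    1 + t ^ 2 / 2 ≤ Real.cosh t := by
  have hsinh : t / 2 ≤ Real.sinh (t / 2) := Real.self_le_sinh_iff.2 (by linarith)
  have hcosh : Real.cosh t = 1 + 2 * Real.sinh (t / 2) ^ 2 := by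
    rw [show t = 2 * (t / 2) by ring, Real.cosh_two_mul, Real.cosh_sq]
    ring_nf
  nlinarith

theorem Real.exp_neg_mul_cosh_sub_le (ν : ℝ) {y t : ℝ} (hy : 1 ≤ y) (ht : 0 ≤ t) :
    Real.exp (-y * Real.cosh t - ν * t) ≤
      Real.exp (ν ^ 2) * Real.exp (-y) * Real.exp (-(y / 4) * t ^ 2) := by
  rw [← Real.exp_add, ← Real.exp_add, Real.exp_le_exp]
  have hcosh := mul_le_mul_of_nonneg_left
    (Real.one_add_sq_div_two_le_cosh_of_nonneg ht) (zero_le_one.trans hy)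
  nlinarith [sq_nonneg (t / 2 + ν), mul_nonneg (sub_nonneg.2 hy) (sq_nonneg t)]

/-- For every `ν ∈ ℝ` there is a constant `C(ν) > 0` such that for all `y ≥ 1`,
`∫_0^∞ e^{−y·cosh t − νt} dt ≤ C · e^{−y}/√y`. -/
theorem integral_exp_neg_cosh_bound (ν : ℝ) :
    ∃ C : ℝ, 0 < C ∧ ∀ y : ℝ, 1 ≤ y →
      (∫ t in Set.Ioi (0:ℝ), Real.exp (-y * Real.cosh t - ν * t)) ≤
        C * (Real.exp (-y) / Real.sqrt y) := by
  refine ⟨Real.exp (ν ^ 2) * Real.sqrt Real.pi, by positivity, fun y hy ↦ ?_⟩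
  have hy0 : 0 < y := zero_lt_one.trans_le hy
  have hsqrt : Real.sqrt (Real.pi / (y / 4)) / 2 = Real.sqrt Real.pi / Real.sqrt y := by
    rw [show Real.pi / (y / 4) = 2 ^ 2 * (Real.pi / y) by field_simp; norm_num,
      Real.sqrt_mul (by positivity), Real.sqrt_sq (by norm_num), Real.sqrt_div Real.pi_pos.le]
    ring
  calc
    _ ≤ ∫ t in Set.Ioi (0:ℝ),
          Real.exp (ν ^ 2) * Real.exp (-y) * Real.exp (-(y / 4) * t ^ 2) := by
      refine MeasureTheory.integral_mono_of_nonneg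
        (Filter.Eventually.of_forall fun t ↦ (Real.exp_pos _).le)
        ((integrable_exp_neg_mul_sq (by positivity)).integrableOn.const_mul _) ?_
      filter_upwards [MeasureTheory.ae_restrict_mem measurableSet_Ioi] with t ht
      exact Real.exp_neg_mul_cosh_sub_le ν hy (le_of_lt ht)
    _ = _ := by
      rw [MeasureTheory.integral_const_mul, integral_gaussian_Ioi, hsqrt]
      ring
end

section
/- For every real number ν and every y ≥ 1, the absolute value of ∫_0^π e^{y·cos θ} · cos(ν θ) dθ is at most 10 · e^{y}/√y. -/
/-- For every `ν ∈ ℝ` and every `y ≥ 1`,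
`|∫_0^π e^{y·cos θ} · cos(νθ) dθ| ≤ 10 · e^{y}/√y`. -/
theorem abs_integral_exp_cos_le (ν y : ℝ) (hy : 1 ≤ y) :
    |∫ θ in (0:ℝ)..Real.pi, Real.exp (y * Real.cos θ) * Real.cos (ν * θ)| ≤
      10 * (Real.exp y / Real.sqrt y) := by
  have hy0 : 0 < y := by linarith
  have hpi := Real.pi_pos
  have hb : 0 < 2 * y / Real.pi ^ 2 := by positivity
  have hint := (integrable_exp_neg_mul_sq hb).const_mul (Real.exp y)
  have hpt : ∀ θ ∈ Set.Ioc 0 Real.pi, ‖Real.exp (y * Real.cos θ) * Real.cos (ν * θ)‖ ≤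
      Real.exp y * Real.exp (-(2 * y / Real.pi ^ 2) * θ ^ 2) := by
    intro θ hθ
    have hcos : Real.cos θ ≤ 1 - 2 / Real.pi ^ 2 * θ ^ 2 :=
      Real.cos_le_one_sub_mul_cos_sq (abs_le.2 ⟨by linarith [hθ.1], hθ.2⟩)
    rw [norm_mul, Real.norm_of_nonneg (Real.exp_pos _).le, ← Real.exp_add]
    refine (mul_le_of_le_one_right (Real.exp_pos _).le (Real.abs_cos_le_one _)).trans
      (Real.exp_le_exp.2 ((mul_le_mul_of_nonneg_left hcos hy0.le).trans_eq ?_))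
    ring
  have hsqrt : √(Real.pi / (2 * y / Real.pi ^ 2)) ≤ 10 / √y := by
    rw [Real.sqrt_le_left (by positivity), div_pow, Real.sq_sqrt hy0.le,
      div_div_eq_mul_div, div_le_div_iff₀ (by positivity) hy0]
    have hpi3 : Real.pi ^ 3 ≤ 4 ^ 3 := pow_le_pow_left₀ hpi.le Real.pi_le_four 3
    nlinarith
  calc |∫ θ in (0:ℝ)..Real.pi, Real.exp (y * Real.cos θ) * Real.cos (ν * θ)|
      ≤ ∫ θ in (0:ℝ)..Real.pi, Real.exp y * Real.exp (-(2 * y / Real.pi ^ 2) * θ ^ 2) :=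
        intervalIntegral.norm_integral_le_of_norm_le hpi.le
          (Filter.Eventually.of_forall hpt) hint.intervalIntegrable
    _ ≤ ∫ θ : ℝ, Real.exp y * Real.exp (-(2 * y / Real.pi ^ 2) * θ ^ 2) := by
        rw [intervalIntegral.integral_of_le hpi.le]
        exact MeasureTheory.setIntegral_le_integral hint
          (Filter.Eventually.of_forall fun θ => by positivity)
    _ = Real.exp y * √(Real.pi / (2 * y / Real.pi ^ 2)) := by
        rw [MeasureTheory.integral_const_mul, integral_gaussian]
    _ ≤ Real.exp y * (10 / √y) := by gcongr
    _ = 10 * (Real.exp y / Real.sqrt y) := by ring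
end

section
/- For every real number ν with ν > −1 and ν ≠ 0, there exist constants C(ν) > 0 and y₀ ≥ 1 such that for all y ≥ y₀, ∫_0^π e^{y·cos θ} · cos(ν θ) dθ ≥ C(ν) · e^{y}/√y. -/
/-- A function bounded below by a constant on `[a, b]` has integral at least that constant times
the length of the interval. -/
theorem const_mul_le_intervalIntegral {f : ℝ → ℝ} (hf : Continuous f) {a b m : ℝ} (hab : a ≤ b)
    (hm : ∀ x ∈ Set.Icc a b, m ≤ f x) : (b - a) * m ≤ ∫ x in a..b, f x := by
  have h := intervalIntegral.integral_mono_on (μ := MeasureTheory.volume) hab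
    (intervalIntegrable_const (c := m)) (hf.intervalIntegrable a b) hm
  simpa using h

/-- For every `ν > −1` with `ν ≠ 0` there exist `C(ν) > 0` and `y₀ ≥ 1` such that for all
`y ≥ y₀`, `∫_0^π e^{y·cos θ} · cos(νθ) dθ ≥ C · e^{y}/√y`. -/
theorem integral_exp_cos_lower_bound (ν : ℝ) (hν : -1 < ν) (hν' : ν ≠ 0) :
    ∃ C : ℝ, 0 < C ∧ ∃ y₀ : ℝ, 1 ≤ y₀ ∧ ∀ y : ℝ, y₀ ≤ y →
      C * (Real.exp y / Real.sqrt y) ≤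
        ∫ θ in (0:ℝ)..Real.pi, Real.exp (y * Real.cos θ) * Real.cos (ν * θ) := by
  obtain ⟨δ, hδ0, hδ1, hδν⟩ : ∃ δ : ℝ, 0 < δ ∧ δ ≤ 1 ∧ |ν| * δ ≤ 1 := by
    have h : 0 < |ν| + 1 := by positivity
    refine ⟨1 / (|ν| + 1), by positivity, ?_, ?_⟩
    · rw [div_le_one h]
      linarith [abs_nonneg ν]
    · rw [mul_one_div, div_le_one h]
      linarith
  have hδπ : δ ≤ Real.pi := by linarith [Real.pi_gt_three]
  have hcos : 0 < 1 - Real.cos δ := by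
    have := Real.cos_lt_cos_of_nonneg_of_le_pi le_rfl hδπ hδ0
    rw [Real.cos_zero] at this
    linarith
  set E := Real.exp (-(1 / 2)) with hE
  have hE0 : 0 < E := Real.exp_pos _
  have htail : ∀ᶠ y : ℝ in Filter.atTop,
      y ^ (1 / 2 : ℝ) * Real.exp (-(1 - Real.cos δ) * y) < δ * E / (4 * Real.pi) :=
    (tendsto_rpow_mul_exp_neg_mul_atTop_nhds_zero _ _ hcos).eventually_lt_const (by positivity)
  obtain ⟨Y, hY⟩ := Filter.eventually_atTop.1 htail
  refine ⟨δ * E / 4, by positivity, max 1 Y, le_max_left _ _, fun y hy => ?_⟩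
  have hy1 : 1 ≤ y := (le_max_left _ _).trans hy
  have hsmall := hY y ((le_max_right _ _).trans hy)
  rw [← Real.sqrt_eq_rpow] at hsmall
  set r := Real.sqrt y with hr
  have hr1 : 1 ≤ r := Real.one_le_sqrt.2 hy1
  have hr0 : 0 < r := by linarith
  have hrsq : r ^ 2 = y := Real.sq_sqrt (by linarith)
  have hs0 : 0 ≤ δ / r := by positivity
  have hsδ : δ / r ≤ δ := div_le_self hδ0.le hr1
  have hf : Continuous fun θ : ℝ => Real.exp (y * Real.cos θ) * Real.cos (ν * θ) := by fun_prop
  have hhalf : ∀ θ : ℝ, 0 ≤ θ → θ ≤ δ → 1 / 2 ≤ Real.cos (ν * θ) := by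
    intro θ h0 h1
    have habs : |ν * θ| ≤ 1 := by
      rw [abs_mul, abs_of_nonneg h0]
      exact (mul_le_mul_of_nonneg_left h1 (abs_nonneg ν)).trans hδν
    have hsq := (sq_le_one_iff_abs_le_one _).2 habs
    linarith [Real.one_sub_sq_div_two_le_cos (x := ν * θ)]
  have hpeak := const_mul_le_intervalIntegral hf (m := Real.exp y * E * (1 / 2)) hs0 (by
    rintro θ ⟨h0, h1⟩
    have hθ : y * θ ^ 2 ≤ 1 := by
      have hrθ : r * θ ≤ 1 := by
        rw [le_div_iff₀ hr0] at h1
        linarith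
      have := pow_le_one₀ (n := 2) (by positivity) hrθ
      rwa [mul_pow, hrsq] at this
    have hexp : Real.exp y * E ≤ Real.exp (y * Real.cos θ) := by
      rw [hE, ← Real.exp_add, Real.exp_le_exp]
      have := mul_le_mul_of_nonneg_left (Real.one_sub_sq_div_two_le_cos (x := θ))
        (by linarith : 0 ≤ y)
      linarith
    exact mul_le_mul hexp (hhalf θ h0 (h1.trans hsδ)) (by norm_num) (Real.exp_pos _).le)
  have hmiddle := const_mul_le_intervalIntegral hf (m := 0) hsδ (by
    rintro θ ⟨h0, h1⟩
    have := hhalf θ (hs0.trans h0) h1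
    exact mul_nonneg (Real.exp_pos _).le (by linarith))
  have hrest := const_mul_le_intervalIntegral hf (m := -Real.exp (y * Real.cos δ)) hδπ (by
    rintro θ ⟨h0, h1⟩
    have hle : Real.exp (y * Real.cos θ) ≤ Real.exp (y * Real.cos δ) := by
      rw [Real.exp_le_exp]
      exact mul_le_mul_of_nonneg_left (Real.cos_le_cos_of_nonneg_of_le_pi hδ0.le h1 h0)
        (by linarith)
    nlinarith [Real.neg_one_le_cos (ν * θ), Real.exp_pos (y * Real.cos θ)])
  rw [← intervalIntegral.integral_add_adjacent_intervals (hf.intervalIntegrable 0 δ)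
      (hf.intervalIntegrable δ Real.pi),
    ← intervalIntegral.integral_add_adjacent_intervals (hf.intervalIntegrable 0 (δ / r))
      (hf.intervalIntegrable (δ / r) δ)]
  have hfactor : Real.exp (y * Real.cos δ) =
      Real.exp y * Real.exp (-(1 - Real.cos δ) * y) := by
    rw [← Real.exp_add]
    congr 1
    ring
  have hbound : Real.pi * Real.exp (y * Real.cos δ) ≤ δ * E / 4 * (Real.exp y / r) := by
    rw [hfactor, mul_div_assoc', le_div_iff₀ hr0]
    rw [lt_div_iff₀ (by positivity)] at hsmall
    have := mul_le_mul_of_nonneg_left hsmall.le (Real.exp_pos y).le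
    linarith
  have hmain : (δ / r - 0) * (Real.exp y * E * (1 / 2)) =
      2 * (δ * E / 4 * (Real.exp y / r)) := by
    ring
  have hδexp := mul_pos hδ0 (Real.exp_pos (y * Real.cos δ))
  linarith
end

section
/- For every integer n ≥ 1 and every y > 0, the derivative of K_{1/n} at y equals −(1/2)·(K_{(n+1)/n}(y) + K_{(n−1)/n}(y)). -/
/-- The modified Bessel function of the second kind,
`K_ν(y) = ∫_0^∞ e^{-y·cosh t} · cosh(ν t) dt`. -/
noncomputable def besselK (ν y : ℝ) : ℝ :=
  ∫ t in Set.Ioi (0:ℝ), Real.exp (-y * Real.cosh t) * Real.cosh (ν * t)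

theorem besselK_neg (ν y : ℝ) : besselK (-ν) y = besselK ν y := by
  simp only [besselK, neg_mul, Real.cosh_neg]

theorem continuous_besselK_integrand (ν y : ℝ) :
    Continuous fun t : ℝ ↦ Real.exp (-y * Real.cosh t) * Real.cosh (ν * t) :=
  (Real.continuous_exp.comp (continuous_const.mul Real.continuous_cosh)).mul
    (Real.continuous_cosh.comp (continuous_const.mul continuous_id))

theorem besselK_integrand_le (ν : ℝ) {y t : ℝ} (hy : 0 < y) (ht : 0 ≤ t) :
    Real.exp (-y * Real.cosh t) * Real.cosh (ν * t) ≤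
      Real.exp ((|ν| + 1) ^ 2 / y) * Real.exp (-1 * t) := by
  have h_cosh_le : Real.cosh (ν * t) ≤ Real.exp (|ν| * t) := by
    rw [← Real.cosh_abs, abs_mul, abs_of_nonneg ht, Real.cosh_eq]
    have h : Real.exp (-(|ν| * t)) ≤ Real.exp (|ν| * t) := by
      have : 0 ≤ |ν| * t := by positivity
      exact Real.exp_le_exp.2 (by linarith)
    linarith
  have h_le_cosh : t ^ 2 / 4 ≤ Real.cosh t := by
    have h := Real.quadratic_le_exp_of_nonneg ht
    have h_pos := Real.exp_pos (-t)
    rw [Real.cosh_eq]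
    linarith
  have h_young : (|ν| + 1) * t ≤ y * (t ^ 2 / 4) + (|ν| + 1) ^ 2 / y := by
    have h : y * (t ^ 2 / 4) + (|ν| + 1) ^ 2 / y - (|ν| + 1) * t =
        (y * t / 2 - (|ν| + 1)) ^ 2 / y := by
      field_simp
      ring
    have h_nonneg : 0 ≤ (y * t / 2 - (|ν| + 1)) ^ 2 / y := by positivity
    linarith
  calc Real.exp (-y * Real.cosh t) * Real.cosh (ν * t)
      ≤ Real.exp (-y * Real.cosh t) * Real.exp (|ν| * t) := by gcongr
    _ = Real.exp (-y * Real.cosh t + |ν| * t) := (Real.exp_add _ _).symm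
    _ ≤ Real.exp ((|ν| + 1) ^ 2 / y + -1 * t) := by
        refine Real.exp_le_exp.2 ?_
        linarith [mul_le_mul_of_nonneg_left h_le_cosh hy.le]
    _ = Real.exp ((|ν| + 1) ^ 2 / y) * Real.exp (-1 * t) := Real.exp_add _ _

theorem integrableOn_besselK_integrand (ν : ℝ) {y : ℝ} (hy : 0 < y) :
    MeasureTheory.IntegrableOn
      (fun t : ℝ ↦ Real.exp (-y * Real.cosh t) * Real.cosh (ν * t)) (Set.Ioi 0) := by
  refine MeasureTheory.Integrable.mono'
    ((exp_neg_integrableOn_Ioi 0 one_pos).const_mul (Real.exp ((|ν| + 1) ^ 2 / y)))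
    (continuous_besselK_integrand ν y).aestronglyMeasurable ?_
  filter_upwards [MeasureTheory.ae_restrict_mem measurableSet_Ioi] with t ht
  rw [Real.norm_of_nonneg (mul_nonneg (Real.exp_pos _).le (Real.cosh_pos _).le)]
  exact besselK_integrand_le ν hy (le_of_lt ht)

theorem cosh_mul_cosh_mul (ν t : ℝ) :
    Real.cosh t * Real.cosh (ν * t) =
      (1 / 2) * (Real.cosh ((ν + 1) * t) + Real.cosh ((ν - 1) * t)) := by
  rw [add_mul, sub_mul, one_mul, Real.cosh_add, Real.cosh_sub]
  ring

/-- The recurrence `K_ν' = -(K_{ν+1} + K_{ν-1}) / 2` for real order. -/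
theorem hasDerivAt_besselK (ν : ℝ) {y : ℝ} (hy : 0 < y) :
    HasDerivAt (besselK ν) (-(1 / 2) * (besselK (ν + 1) y + besselK (ν - 1) y)) y := by
  have h_integrable (x : ℝ) (hx : 0 < x) := (integrableOn_besselK_integrand (ν + 1) hx).add
    (integrableOn_besselK_integrand (ν - 1) hx)
  have h_deriv := (hasDerivAt_integral_of_dominated_loc_of_deriv_le
    (μ := MeasureTheory.volume.restrict (Set.Ioi (0 : ℝ))) (Ioi_mem_nhds (half_lt_self hy))
    (F := fun x t ↦ Real.exp (-x * Real.cosh t) * Real.cosh (ν * t))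
    (F' := fun x t ↦ -(1 / 2) * (Real.exp (-x * Real.cosh t) * Real.cosh ((ν + 1) * t) +
      Real.exp (-x * Real.cosh t) * Real.cosh ((ν - 1) * t)))
    (bound := fun t ↦ (1 / 2) * (Real.exp (-(y / 2) * Real.cosh t) * Real.cosh ((ν + 1) * t) +
      Real.exp (-(y / 2) * Real.cosh t) * Real.cosh ((ν - 1) * t)))
    (.of_forall fun x ↦ (continuous_besselK_integrand ν x).aestronglyMeasurable)
    (integrableOn_besselK_integrand ν hy)
    ((h_integrable y hy).const_mul _).aestronglyMeasurable
    (.of_forall fun t x hx ↦ ?_)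
    ((h_integrable _ (half_pos hy)).const_mul _)
    (.of_forall fun t x _ ↦ ?_)).2
  · rw [MeasureTheory.integral_const_mul, MeasureTheory.integral_add
      (integrableOn_besselK_integrand (ν + 1) hy)
      (integrableOn_besselK_integrand (ν - 1) hy)] at h_deriv
    exact h_deriv
  · have h_cosh := Real.cosh_pos t
    have h_plus := Real.cosh_pos ((ν + 1) * t)
    have h_minus := Real.cosh_pos ((ν - 1) * t)
    have h_exp : Real.exp (-x * Real.cosh t) ≤ Real.exp (-(y / 2) * Real.cosh t) :=
      Real.exp_le_exp.2 (mul_le_mul_of_nonneg_right (neg_le_neg (le_of_lt hx)) h_cosh.le)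
    rw [norm_mul, norm_neg, Real.norm_of_nonneg (by norm_num : (0 : ℝ) ≤ 1 / 2),
      Real.norm_of_nonneg (by positivity)]
    gcongr
  · have h := (((hasDerivAt_id x).neg.mul_const (Real.cosh t)).exp).mul_const
      (Real.cosh (ν * t))
    refine h.congr_deriv ?_
    simp only [Pi.neg_apply, id]
    linear_combination -Real.exp (-x * Real.cosh t) * cosh_mul_cosh_mul ν t

/-- For every integer `n ≥ 1` and every `y > 0`, the derivative of `K_{1/n}` at `y` equals
`−(1/2)·(K_{(n+1)/n}(y) + K_{(n−1)/n}(y))`. -/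
theorem besselK_hasDerivAt (n : ℕ) (hn : 1 ≤ n) (y : ℝ) (hy : 0 < y) :
    HasDerivAt (besselK (1 / (n : ℝ)))
      (-(1/2) * (besselK (((n : ℝ) + 1) / n) y + besselK (((n : ℝ) - 1) / n) y)) y := by
  have hn' : (n : ℝ) ≠ 0 := by positivity
  have h_plus : ((n : ℝ) + 1) / n = 1 / n + 1 := by field_simp; ring
  have h_minus : ((n : ℝ) - 1) / n = -(1 / n - 1) := by field_simp; ring
  rw [h_plus, h_minus, besselK_neg]
  exact hasDerivAt_besselK _ hy
end

section
/- Let n ≥ 3 be an integer and λ > 0. Then the functions D and G are twice differentiable on (0, ∞) and satisfy the ordinary differential equation u''(z) = n·λ·z^{n−2}·u(z) for all z > 0. -/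
/-- The modified Bessel function of the first kind,
`I_ν(y) = (1/π)∫_0^π e^{y·cos θ}·cos(νθ) dθ − (sin(νπ)/π)∫_0^∞ e^{-y·cosh t − νt} dt`. -/
noncomputable def besselI (ν y : ℝ) : ℝ :=
  (1 / Real.pi) * ∫ θ in (0:ℝ)..Real.pi, Real.exp (y * Real.cos θ) * Real.cos (ν * θ)
    - (Real.sin (ν * Real.pi) / Real.pi) *
      ∫ t in Set.Ioi (0:ℝ), Real.exp (-y * Real.cosh t - ν * t)

/-- The decaying solution `D(z) = √z · K_{1/n}(2·√(λ/n)·z^{n/2})`. -/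
noncomputable def calD (n : ℕ) (lam z : ℝ) : ℝ :=
  Real.sqrt z * besselK (1 / (n : ℝ)) (2 * Real.sqrt (lam / n) * z ^ ((n : ℝ) / 2))

/-- The growing solution `G(z) = √z · I_{1/n}(2·√(λ/n)·z^{n/2})`. -/
noncomputable def calG (n : ℕ) (lam z : ℝ) : ℝ :=
  Real.sqrt z * besselI (1 / (n : ℝ)) (2 * Real.sqrt (lam / n) * z ^ ((n : ℝ) / 2))

open Set Filter Topology MeasureTheory

/-- The integrand of the `k`-th derivative, up to sign, of
`y ↦ ∫_0^∞ e^{-y·cosh t − νt} dt`. -/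
noncomputable def coshPowExp (k : ℕ) (ν y t : ℝ) : ℝ :=
  Real.cosh t ^ k * Real.exp (-y * Real.cosh t - ν * t)

/-- `w` is twice differentiable on `(0,∞)` and solves the modified Bessel equation of order `ν`
with inhomogeneity `c·e^{-y}`. -/
def SolvesModifiedBessel (ν c : ℝ) (w : ℝ → ℝ) : Prop :=
  ∃ w₁ w₂ : ℝ → ℝ, ∀ y, 0 < y → HasDerivAt w (w₁ y) y ∧ HasDerivAt w₁ (w₂ y) y ∧
    y ^ 2 * w₂ y + y * w₁ y - (y ^ 2 + ν ^ 2) * w y = c * Real.exp (-y)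

theorem SolvesModifiedBessel.linearCombination {ν c d a b : ℝ} {v w : ℝ → ℝ}
    (hv : SolvesModifiedBessel ν c v) (hw : SolvesModifiedBessel ν d w) :
    SolvesModifiedBessel ν (a * c + b * d) (fun y => a * v y + b * w y) := by
  obtain ⟨v₁, v₂, hv⟩ := hv
  obtain ⟨w₁, w₂, hw⟩ := hw
  refine ⟨fun y => a * v₁ y + b * w₁ y, fun y => a * v₂ y + b * w₂ y, fun y hy => ?_⟩
  obtain ⟨hv₁, hv₂, hv₃⟩ := hv y hy
  obtain ⟨hw₁, hw₂, hw₃⟩ := hw y hy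
  refine ⟨(hv₁.const_mul a).add (hw₁.const_mul b), (hv₂.const_mul a).add (hw₂.const_mul b), ?_⟩
  linear_combination a * hv₃ + b * hw₃

theorem SolvesModifiedBessel.congr {ν c : ℝ} {v w : ℝ → ℝ}
    (hv : SolvesModifiedBessel ν c v) (h : ∀ y, 0 < y → w y = v y) :
    SolvesModifiedBessel ν c w := by
  obtain ⟨v₁, v₂, hv⟩ := hv
  refine ⟨v₁, v₂, fun y hy => ?_⟩
  obtain ⟨hv₁, hv₂, hv₃⟩ := hv y hy
  refine ⟨hv₁.congr_of_eventuallyEq ?_, hv₂, by rw [h y hy]; exact hv₃⟩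
  filter_upwards [lt_mem_nhds hy] with x hx using h x hx

theorem continuous_coshPowExp (k : ℕ) (ν y : ℝ) : Continuous (coshPowExp k ν y) := by
  unfold coshPowExp
  fun_prop

theorem tendsto_cosh_atTop : Tendsto Real.cosh atTop atTop := by
  refine tendsto_atTop_mono (f := fun t => Real.exp t / 2) (fun t => ?_)
    (Real.tendsto_exp_atTop.atTop_div_const (by norm_num))
  rw [Real.cosh_eq]
  linarith [Real.exp_pos (-t)]

theorem tendsto_coshPowExp (k : ℕ) (ν : ℝ) {y : ℝ} (hy : 0 < y) :
    Tendsto (coshPowExp k ν y) atTop (𝓝 0) := by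
  obtain ⟨m, hm⟩ := exists_nat_ge (-ν)
  have h := ((Real.tendsto_pow_mul_exp_neg_atTop_nhds_zero (k + m)).comp
    (tendsto_cosh_atTop.const_mul_atTop hy)).const_mul (2 ^ m / y ^ (k + m))
  rw [mul_zero] at h
  refine squeeze_zero' (Eventually.of_forall fun t => ?_) ?_ h
  · have := Real.cosh_pos t
    unfold coshPowExp
    positivity
  filter_upwards [eventually_ge_atTop 0] with t ht
  have hexp : Real.exp (-ν * t) ≤ (2 * Real.cosh t) ^ m := by
    calc Real.exp (-ν * t) ≤ Real.exp (m * t) :=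
          Real.exp_le_exp.2 (mul_le_mul_of_nonneg_right hm ht)
      _ = Real.exp t ^ m := Real.exp_nat_mul t m
      _ ≤ _ := by
        gcongr
        linarith [Real.cosh_eq t, Real.exp_pos (-t)]
  have hc := Real.cosh_pos t
  calc coshPowExp k ν y t
      = Real.cosh t ^ k * Real.exp (-(y * Real.cosh t)) * Real.exp (-ν * t) := by
        rw [coshPowExp, mul_assoc, ← Real.exp_add]
        ring_nf
    _ ≤ Real.cosh t ^ k * Real.exp (-(y * Real.cosh t)) * (2 * Real.cosh t) ^ m := by gcongr
    _ = _ := by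
        simp only [Function.comp_apply]
        field_simp
        ring

theorem integrableOn_coshPowExp (k : ℕ) (ν : ℝ) {y : ℝ} (hy : 0 < y) :
    IntegrableOn (coshPowExp k ν y) (Ioi 0) := by
  refine integrable_of_isBigO_exp_neg one_pos (continuous_coshPowExp k ν y).continuousOn ?_
  have h := ((tendsto_coshPowExp k (ν - 1) hy).isBigO_one ℝ).mul
    (Asymptotics.isBigO_refl (fun t : ℝ => Real.exp (-1 * t)) atTop)
  refine h.congr (fun t => ?_) (fun t => one_mul _)
  rw [coshPowExp, coshPowExp, mul_assoc, ← Real.exp_add]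
  ring_nf

theorem hasDerivAt_integral_coshPowExp (k : ℕ) (ν : ℝ) {y : ℝ} (hy : 0 < y) :
    HasDerivAt (fun x => ∫ t in Ioi (0:ℝ), coshPowExp k ν x t)
      (-∫ t in Ioi (0:ℝ), coshPowExp (k + 1) ν y t) y := by
  rw [← integral_neg]
  refine (hasDerivAt_integral_of_dominated_loc_of_deriv_le (Ioi_mem_nhds (half_lt_self hy))
    (Eventually.of_forall fun x => (continuous_coshPowExp k ν x).aestronglyMeasurable)
    (integrableOn_coshPowExp k ν hy)
    (F' := fun x t => -coshPowExp (k + 1) ν x t)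
    (continuous_coshPowExp (k + 1) ν y).neg.aestronglyMeasurable
    (bound := coshPowExp (k + 1) ν (y / 2)) (Eventually.of_forall fun t x hx => ?_)
    (integrableOn_coshPowExp (k + 1) ν (half_pos hy))
    (Eventually.of_forall fun t x _ => ?_)).2
  · have hc := Real.cosh_pos t
    have hx' : y / 2 ≤ x := le_of_lt hx
    rw [norm_neg, Real.norm_of_nonneg (by unfold coshPowExp; positivity)]
    unfold coshPowExp
    gcongr
  · have h := ((((hasDerivAt_id x).neg.mul_const (Real.cosh t)).sub_const (ν * t)).exp).const_mul
      (Real.cosh t ^ k)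
    refine h.congr_deriv ?_
    simp only [coshPowExp, Pi.neg_apply, id]
    ring

theorem tendsto_exp_mul_sinh (ν : ℝ) {y : ℝ} (hy : 0 < y) :
    Tendsto (fun t => Real.exp (-y * Real.cosh t - ν * t) * (-y * Real.sinh t + ν))
      atTop (𝓝 0) := by
  have h := ((tendsto_coshPowExp 1 ν hy).const_mul y).add
    ((tendsto_coshPowExp 0 ν hy).const_mul |ν|)
  rw [mul_zero, mul_zero, add_zero] at h
  refine squeeze_zero_norm (fun t => ?_) h
  have hs : |Real.sinh t| ≤ Real.cosh t :=
    abs_le_of_sq_le_sq (by linarith [Real.cosh_sq t]) (Real.cosh_pos t).le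
  have hb : |-y * Real.sinh t + ν| ≤ y * Real.cosh t + |ν| := by
    refine (abs_add_le _ _).trans ?_
    rw [abs_mul, abs_neg, abs_of_pos hy]
    gcongr
  rw [norm_mul, Real.norm_of_nonneg (Real.exp_pos _).le, Real.norm_eq_abs]
  refine (mul_le_mul_of_nonneg_left hb (Real.exp_pos _).le).trans_eq ?_
  simp only [coshPowExp]
  ring

theorem solvesModifiedBessel_integral_exp_cosh (ν : ℝ) :
    SolvesModifiedBessel ν (-ν)
      (fun y => ∫ t in Ioi (0:ℝ), Real.exp (-y * Real.cosh t - ν * t)) := by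
  have hzero : (fun y => ∫ t in Ioi (0:ℝ), Real.exp (-y * Real.cosh t - ν * t)) =
      fun y => ∫ t in Ioi (0:ℝ), coshPowExp 0 ν y t := by
    simp [coshPowExp]
  rw [hzero]
  refine ⟨fun y => -∫ t in Ioi (0:ℝ), coshPowExp 1 ν y t,
    fun y => ∫ t in Ioi (0:ℝ), coshPowExp 2 ν y t, fun y hy =>
    ⟨hasDerivAt_integral_coshPowExp 0 ν hy, ?_, ?_⟩⟩
  · exact (hasDerivAt_integral_coshPowExp 1 ν hy).neg.congr_deriv (neg_neg _)
  have hi (k : ℕ) := integrableOn_coshPowExp k ν hy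
  have hi₂₁ : IntegrableOn
      (fun t => y ^ 2 * coshPowExp 2 ν y t - y * coshPowExp 1 ν y t) (Ioi 0) :=
    ((hi 2).const_mul (y ^ 2)).sub ((hi 1).const_mul y)
  have hi₀ := (hi 0).const_mul (y ^ 2 + ν ^ 2)
  have hFTC := integral_Ioi_of_hasDerivAt_of_tendsto' (a := 0) (fun t _ => ?_) (hi₂₁.sub hi₀)
    (tendsto_exp_mul_sinh ν hy)
  · simp only [Pi.sub_apply] at hFTC
    rw [integral_sub hi₂₁ hi₀,
      integral_sub ((hi 2).const_mul (y ^ 2))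
      ((hi 1).const_mul y), integral_const_mul, integral_const_mul, integral_const_mul] at hFTC
    simp only [Real.cosh_zero, Real.sinh_zero, mul_zero, mul_one, sub_zero, zero_add,
      zero_sub] at hFTC
    linear_combination hFTC
  · have h := ((((Real.hasDerivAt_cosh t).const_mul (-y)).sub
      ((hasDerivAt_id t).const_mul ν)).exp).mul
      (((Real.hasDerivAt_sinh t).const_mul (-y)).add_const ν)
    refine h.congr_deriv ?_
    simp only [coshPowExp, Pi.sub_apply, id]
    linear_combination y ^ 2 * Real.exp (-y * Real.cosh t - ν * t) * Real.sinh_sq t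

theorem hasDerivAt_integral_cos_pow_mul_exp (k : ℕ) (ν y : ℝ) :
    HasDerivAt (fun x => ∫ θ in (0:ℝ)..Real.pi,
        Real.cos θ ^ k * (Real.exp (x * Real.cos θ) * Real.cos (ν * θ)))
      (∫ θ in (0:ℝ)..Real.pi,
        Real.cos θ ^ (k + 1) * (Real.exp (y * Real.cos θ) * Real.cos (ν * θ))) y := by
  refine (intervalIntegral.hasDerivAt_integral_of_dominated_loc_of_deriv_le
    (Metric.ball_mem_nhds y one_pos)
    (Eventually.of_forall fun x => Continuous.aestronglyMeasurable (by fun_prop))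
    (Continuous.intervalIntegrable (by fun_prop) _ _)
    (F' := fun x θ => Real.cos θ ^ (k + 1) * (Real.exp (x * Real.cos θ) * Real.cos (ν * θ)))
    (Continuous.aestronglyMeasurable (by fun_prop))
    (bound := fun _ => Real.exp (|y| + 1)) (Eventually.of_forall fun θ _ x hx => ?_)
    intervalIntegrable_const (Eventually.of_forall fun θ _ x _ => ?_)).2
  · have hx' : |x| ≤ |y| + 1 := by
      rw [Metric.mem_ball, Real.dist_eq] at hx
      linarith [abs_sub_abs_le_abs_sub x y]
    have hexp : x * Real.cos θ ≤ |y| + 1 := by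
      refine (le_abs_self _).trans ?_
      rw [abs_mul]
      exact (mul_le_of_le_one_right (abs_nonneg _) (Real.abs_cos_le_one θ)).trans hx'
    rw [norm_mul, norm_mul, norm_pow, Real.norm_of_nonneg (Real.exp_pos _).le]
    calc ‖Real.cos θ‖ ^ (k + 1) * (Real.exp (x * Real.cos θ) * ‖Real.cos (ν * θ)‖)
        ≤ 1 * (Real.exp (|y| + 1) * 1) := by
          gcongr
          · exact pow_le_one₀ (norm_nonneg _) (Real.abs_cos_le_one θ)
          · exact Real.abs_cos_le_one _
      _ = _ := by ring
  · have h := ((((hasDerivAt_id x).mul_const (Real.cos θ)).exp).mul_const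
      (Real.cos (ν * θ))).const_mul (Real.cos θ ^ k)
    refine h.congr_deriv ?_
    simp only [id]
    ring

theorem solvesModifiedBessel_integral_exp_cos (ν : ℝ) :
    SolvesModifiedBessel ν (-ν * Real.sin (ν * Real.pi))
      (fun y => ∫ θ in (0:ℝ)..Real.pi, Real.exp (y * Real.cos θ) * Real.cos (ν * θ)) := by
  have hd (k : ℕ) (y : ℝ) := hasDerivAt_integral_cos_pow_mul_exp k ν y
  refine ⟨_, _, fun y _ => ⟨by simpa using hd 0 y, by simpa using hd 1 y, ?_⟩⟩
  have hFTC := intervalIntegral.integral_eq_sub_of_hasDerivAt (a := 0) (b := Real.pi)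
    (f := fun θ => Real.exp (y * Real.cos θ) *
      (y * Real.sin θ * Real.cos (ν * θ) - ν * Real.sin (ν * θ)))
    (f' := fun θ => y ^ 2 * (Real.cos θ ^ 2 * (Real.exp (y * Real.cos θ) * Real.cos (ν * θ)))
      + y * (Real.cos θ * (Real.exp (y * Real.cos θ) * Real.cos (ν * θ)))
      - (y ^ 2 + ν ^ 2) * (Real.exp (y * Real.cos θ) * Real.cos (ν * θ))) (fun θ _ => ?_)
    (Continuous.intervalIntegrable (by fun_prop) _ _)
  · rw [intervalIntegral.integral_sub (Continuous.intervalIntegrable (by fun_prop) _ _)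
      (Continuous.intervalIntegrable (by fun_prop) _ _),
      intervalIntegral.integral_add (Continuous.intervalIntegrable (by fun_prop) _ _)
      (Continuous.intervalIntegrable (by fun_prop) _ _),
      intervalIntegral.integral_const_mul, intervalIntegral.integral_const_mul,
      intervalIntegral.integral_const_mul] at hFTC
    rw [hFTC]
    simp
    ring
  · have hν := (hasDerivAt_id θ).const_mul ν
    have h := (((Real.hasDerivAt_cos θ).const_mul y).exp).mul
      ((((Real.hasDerivAt_sin θ).const_mul y).mul hν.cos).sub (hν.sin.const_mul ν))
    refine h.congr_deriv ?_
    simp only [Pi.mul_apply, Pi.sub_apply, id]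
    linear_combination (-y ^ 2) * Real.exp (y * Real.cos θ) * Real.cos (ν * θ) *
      Real.sin_sq θ

theorem solvesModifiedBessel_besselK (ν : ℝ) : SolvesModifiedBessel ν 0 (besselK ν) := by
  have hneg : SolvesModifiedBessel ν ν
      (fun y => ∫ t in Ioi (0:ℝ), Real.exp (-y * Real.cosh t - -ν * t)) := by
    simpa [SolvesModifiedBessel] using solvesModifiedBessel_integral_exp_cosh (-ν)
  have h := (solvesModifiedBessel_integral_exp_cosh ν).linearCombination hneg
    (a := 1 / 2) (b := 1 / 2)
  rw [show 1 / 2 * -ν + 1 / 2 * ν = 0 by ring] at h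
  refine h.congr fun y hy => ?_
  have hi (μ : ℝ) : IntegrableOn (fun t => Real.exp (-y * Real.cosh t - μ * t)) (Ioi 0) := by
    have h := integrableOn_coshPowExp 0 μ hy
    unfold coshPowExp at h
    simpa only [pow_zero, one_mul] using h
  rw [← mul_add, ← integral_add (hi ν) (hi (-ν)), ← integral_const_mul, besselK]
  congr 1 with t
  rw [Real.cosh_eq (ν * t), sub_eq_add_neg, sub_eq_add_neg, Real.exp_add, Real.exp_add]
  ring_nf

theorem solvesModifiedBessel_besselI (ν : ℝ) : SolvesModifiedBessel ν 0 (besselI ν) := by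
  have h := (solvesModifiedBessel_integral_exp_cos ν).linearCombination
    (solvesModifiedBessel_integral_exp_cosh ν)
    (a := 1 / Real.pi) (b := -(Real.sin (ν * Real.pi) / Real.pi))
  rw [show 1 / Real.pi * (-ν * Real.sin (ν * Real.pi)) +
    -(Real.sin (ν * Real.pi) / Real.pi) * -ν = 0 by ring] at h
  refine h.congr fun y _ => ?_
  rw [besselI, intervalIntegral.integral_sub (Continuous.intervalIntegrable (by fun_prop) _ _)
    intervalIntegrable_const, intervalIntegral.integral_const, smul_eq_mul]
  field_simp
  ring

/-- If `w` solves the modified Bessel equation of order `1/(2a)`, then `u(z) = √z · w(c·z^a)`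
solves `u'' = a²c²z^{2a−2}·u`. -/
theorem SolvesModifiedBessel.sqrt_mul_comp_rpow {ν a c : ℝ} {w : ℝ → ℝ}
    (hw : SolvesModifiedBessel ν 0 w) (hc : 0 < c) (ha : a * ν = 1 / 2) {z : ℝ} (hz : 0 < z) :
    let u := fun x : ℝ => √x * w (c * x ^ a)
    DifferentiableAt ℝ u z ∧ DifferentiableAt ℝ (deriv u) z ∧
      deriv (deriv u) z = a ^ 2 * c ^ 2 * z ^ (2 * a - 2) * u z := by
  intro u
  obtain ⟨w₁, w₂, hw⟩ := hw
  have hpow (p : ℝ) {x : ℝ} (hx : 0 < x) : HasDerivAt (fun x : ℝ => x ^ p) (p * x ^ (p - 1)) x :=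
    Real.hasDerivAt_rpow_const (Or.inl hx.ne')
  have hy {x : ℝ} (hx : 0 < x) : 0 < c * x ^ a := mul_pos hc (Real.rpow_pos_of_pos hx a)
  have hu_eq : u = fun x : ℝ => x ^ (1 / 2 : ℝ) * w (c * x ^ a) := by
    simp only [u, Real.sqrt_eq_rpow]
  let u₁ : ℝ → ℝ := fun x => 1 / 2 * x ^ (1 / 2 - 1 : ℝ) * w (c * x ^ a) +
    x ^ (1 / 2 : ℝ) * (w₁ (c * x ^ a) * (c * (a * x ^ (a - 1))))
  have hu {x : ℝ} (hx : 0 < x) : HasDerivAt u (u₁ x) x := by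
    rw [hu_eq]
    exact (hpow (1 / 2) hx).mul ((hw _ (hy hx)).1.comp x ((hpow a hx).const_mul c))
  have hderiv : deriv u =ᶠ[𝓝 z] u₁ := by
    filter_upwards [lt_mem_nhds hz] with x hx using (hu hx).deriv
  have hu₁ := (((hpow (1 / 2 - 1) hz).const_mul (1 / 2)).mul
      ((hw _ (hy hz)).1.comp z ((hpow a hz).const_mul c))).add
    ((hpow (1 / 2) hz).mul (((hw _ (hy hz)).2.1.comp z ((hpow a hz).const_mul c)).mul
      (((hpow (a - 1) hz).const_mul a).const_mul c)))
  have hu₂ := HasDerivAt.congr_of_eventuallyEq hu₁ hderiv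
  refine ⟨(hu hz).differentiableAt, hu₂.differentiableAt, hu₂.deriv.trans ?_⟩
  have hode := (hw _ (hy hz)).2.2
  have h2a : z ^ (2 * a - 2) = (z ^ a) ^ 2 / z ^ 2 := by
    rw [Real.rpow_sub hz, two_mul, Real.rpow_add hz, Real.rpow_two]
    ring
  simp only [u, Function.comp_apply, Pi.mul_apply, Real.sqrt_eq_rpow, h2a, Real.rpow_sub hz, Real.rpow_one]
  generalize z ^ a = P at *
  generalize z ^ (1 / 2 : ℝ) = s at *
  field_simp
  linear_combination 4 * s * a ^ 2 * hode + 4 * s * w (c * P) * (a * ν + 1 / 2) * ha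

/-- For an integer `n ≥ 3` and `λ > 0`, the functions `D` and `G` are twice differentiable on
`(0,∞)` and satisfy the ODE `u''(z) = n·λ·z^{n−2}·u(z)` there. -/
theorem calD_calG_solve_ODE (n : ℕ) (hn : 3 ≤ n) (lam : ℝ) (hlam : 0 < lam) :
    ∀ z : ℝ, 0 < z →
      (DifferentiableAt ℝ (calD n lam) z ∧ DifferentiableAt ℝ (deriv (calD n lam)) z ∧
        deriv (deriv (calD n lam)) z = n * lam * z ^ ((n : ℝ) - 2) * calD n lam z) ∧
      (DifferentiableAt ℝ (calG n lam) z ∧ DifferentiableAt ℝ (deriv (calG n lam)) z ∧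
        deriv (deriv (calG n lam)) z = n * lam * z ^ ((n : ℝ) - 2) * calG n lam z) := by
  intro z hz
  have hn' : (0 : ℝ) < n := by positivity
  have hc : 0 < 2 * √(lam / n) := by positivity
  have hcoef : ((n : ℝ) / 2) ^ 2 * (2 * √(lam / n)) ^ 2 = n * lam := by
    rw [mul_pow, Real.sq_sqrt (by positivity)]
    field_simp
  have key {w : ℝ → ℝ} (hw : SolvesModifiedBessel (1 / (n : ℝ)) 0 w) :=
    hw.sqrt_mul_comp_rpow (a := (n : ℝ) / 2) hc (by field_simp) hz
  simp only [hcoef, mul_div_cancel₀ (n : ℝ) two_ne_zero] at key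
  exact ⟨key (solvesModifiedBessel_besselK _), key (solvesModifiedBessel_besselI _)⟩
end

section
/- Let n ≥ 3 be an integer, let λ₁ > 0 and δ ∈ ℝ. There exists a constant C > 1, depending only on n, λ₁ and δ, with the following property: for every λ ≥ λ₁, every constant C₀ > 0, and every continuous function v : (1, ∞) → ℝ with |v(z)| ≤ C₀·z^δ for all z > 1, there exists a twice continuously differentiable function u : (1, ∞) → ℝ solving u''(z) = n·λ·z^{n−2}·u(z) + n·z^{n−1}·v(z) for all z > 1, such that |u(z)| ≤ C·C₀·z^{δ+1}, |u'(z)| ≤ C·C₀·z^{δ+n/2}, and |u''(z)| ≤ C·C₀·z^{δ+n−1} for all z > C. -/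
open Set in
/-- A continuous function on `(a, ∞)` has a primitive there vanishing at a prescribed point. -/
theorem exists_primitive_Ioi {f : ℝ → ℝ} {a b : ℝ} (hf : ContinuousOn f (Ioi a)) (hb : a < b) :
    ∃ F : ℝ → ℝ, F b = 0 ∧ ∀ x, a < x → HasDerivAt F (f x) x := by
  refine ⟨fun x => ∫ t in b..x, f t, by simp, fun x hx => ?_⟩
  refine intervalIntegral.integral_hasDerivAt_right ?_ ?_ (hf.continuousAt (Ioi_mem_nhds hx))
  · refine (hf.mono fun t ht => ?_).intervalIntegrable
    exact lt_of_lt_of_le (lt_min hb hx) ht.1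
  · exact ContinuousOn.stronglyMeasurableAtFilter isOpen_Ioi hf x hx

open Set in
theorem monotoneOn_Ici_of_hasDerivAt_nonneg {f f' : ℝ → ℝ} {a : ℝ}
    (hf : ∀ x, a ≤ x → HasDerivAt f (f' x) x) (hf' : ∀ x, a ≤ x → 0 ≤ f' x) :
    MonotoneOn f (Ici a) := by
  refine monotoneOn_of_hasDerivWithinAt_nonneg (f' := f') (convex_Ici a)
    (fun x hx => (hf x hx).continuousAt.continuousWithinAt) (fun x hx => ?_) (fun x hx => ?_)
  · exact (hf x (interior_subset hx)).hasDerivWithinAt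
  · exact hf' x (interior_subset hx)

/-- The Taylor coefficients (in powers of `z ^ (N + 2)`) of the solution of `y'' = c z ^ N y`
with `y 0 = 1`, `y' 0 = 0`. -/
noncomputable def airyCoeff (c : ℝ) (N : ℕ) : ℕ → ℝ
  | 0 => 1
  | k + 1 => c * airyCoeff c N k / (((N + 2) * k + (N + 2) : ℕ) * ((N + 2) * k + (N + 1) : ℕ))

theorem airyCoeff_nonneg {c : ℝ} (hc : 0 ≤ c) (N k : ℕ) : 0 ≤ airyCoeff c N k := by
  induction k with
  | zero => simp [airyCoeff]
  | succ k ih => rw [airyCoeff]; positivity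

theorem airyCoeff_le {c : ℝ} (hc : 0 ≤ c) (N k : ℕ) :
    airyCoeff c N k ≤ c ^ k / (k.factorial : ℝ) := by
  induction k with
  | zero => simp [airyCoeff]
  | succ k ih =>
    rw [airyCoeff, Nat.factorial_succ, pow_succ]
    have h1 : ((k + 1 : ℕ) : ℝ) ≤ ((N + 2) * k + (N + 2) : ℕ) * ((N + 2) * k + (N + 1) : ℕ) := by
      rw [← Nat.cast_mul, Nat.cast_le]
      calc k + 1 = (k + 1) * 1 := by ring
        _ ≤ _ := Nat.mul_le_mul (by nlinarith) (by omega)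
    have h2 : (0 : ℝ) < ((k + 1 : ℕ) : ℝ) := by positivity
    calc _ ≤ c * (c ^ k / (k.factorial : ℝ)) / ((k + 1 : ℕ) : ℝ) := by gcongr
      _ = _ := by push_cast; field_simp

open Set in
/-- The equation `y'' = c z ^ N y` has an entire solution that is positive and nondecreasing on
`[0, ∞)`. -/
theorem exists_pos_monotone_solution {c : ℝ} (hc : 0 ≤ c) (N : ℕ) :
    ∃ y y' : ℝ → ℝ, (∀ z, HasDerivAt y (y' z) z) ∧ (∀ z, HasDerivAt y' (c * z ^ N * y z) z) ∧
      ∀ z, 0 ≤ z → 0 < y z ∧ 0 ≤ y' z := by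
  let a := airyCoeff c N
  have ha0 : ∀ k, 0 ≤ a k := airyCoeff_nonneg hc N
  let t0 : ℕ → ℝ → ℝ := fun k z => a (k + 1) * z ^ ((N + 2) * k + (N + 2))
  let t1 : ℕ → ℝ → ℝ := fun k z => c * a k / ((N + 2) * k + (N + 1) : ℕ)
    * z ^ ((N + 2) * k + (N + 1))
  let t2 : ℕ → ℝ → ℝ := fun k z => c * a k * z ^ ((N + 2) * k + N)
  have hd0 : ∀ k z, HasDerivAt (t0 k) (t1 k z) z := by
    intro k z
    have h := (hasDerivAt_pow ((N + 2) * k + (N + 2)) z).const_mul (a (k + 1))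
    refine h.congr_deriv ?_
    simp only [t1, a, airyCoeff]
    have : (N + 2) * k + (N + 2) - 1 = (N + 2) * k + (N + 1) := by omega
    rw [this]
    field_simp
  have hd1 : ∀ k z, HasDerivAt (t1 k) (t2 k z) z := by
    intro k z
    have h := (hasDerivAt_pow ((N + 2) * k + (N + 1)) z).const_mul
      (c * a k / ((N + 2) * k + (N + 1) : ℕ))
    refine h.congr_deriv ?_
    simp only [t2]
    have : (N + 2) * k + (N + 1) - 1 = (N + 2) * k + N := by omega
    rw [this]
    field_simp
  let b : ℝ → ℕ → ℝ := fun R k => c * R ^ (N + 1) * ((c * R ^ (N + 2)) ^ k / k.factorial)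
  have hb : ∀ R, Summable (b R) := fun R => (Real.summable_pow_div_factorial _).mul_left _
  have hpow : ∀ R k z, 1 ≤ R → |z| ≤ R → ∀ j ≤ N + 1,
      c * a k * |z| ^ ((N + 2) * k + j) ≤ b R k := by
    intro R k z hR hz j hj
    have h1 : |z| ^ ((N + 2) * k + j) ≤ R ^ ((N + 2) * k + (N + 1)) :=
      (pow_le_pow_left₀ (abs_nonneg z) hz _).trans (pow_le_pow_right₀ hR (by omega))
    have h2 := airyCoeff_le hc N k
    calc c * a k * |z| ^ ((N + 2) * k + j)
        ≤ c * (c ^ k / k.factorial) * R ^ ((N + 2) * k + (N + 1)) := by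
          gcongr
      _ = b R k := by simp only [b]; rw [pow_add, pow_mul, mul_pow]; ring
  have hb1 : ∀ R k z, 1 ≤ R → |z| ≤ R → ‖t1 k z‖ ≤ b R k := by
    intro R k z hR hz
    refine le_trans ?_ (hpow R k z hR hz (N + 1) le_rfl)
    have : (1 : ℝ) ≤ ((N + 2) * k + (N + 1) : ℕ) := by
      exact_mod_cast (by omega : 1 ≤ (N + 2) * k + (N + 1))
    have h0 : 0 ≤ c * a k := mul_nonneg hc (ha0 k)
    rw [Real.norm_eq_abs, abs_mul, abs_pow, abs_of_nonneg (by positivity)]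
    gcongr
    exact div_le_self h0 this
  have hb2 : ∀ R k z, 1 ≤ R → |z| ≤ R → ‖t2 k z‖ ≤ b R k := by
    intro R k z hR hz
    refine le_trans ?_ (hpow R k z hR hz N (by omega))
    rw [Real.norm_eq_abs, abs_mul, abs_pow, abs_of_nonneg (mul_nonneg hc (ha0 k))]
  have hmem : ∀ z : ℝ, z ∈ Metric.ball (0 : ℝ) (|z| + 1) := fun z => by simp
  have hmem0 : ∀ z : ℝ, (0 : ℝ) ∈ Metric.ball (0 : ℝ) (|z| + 1) := fun z => by
    simp; positivity
  have hle : ∀ z x : ℝ, x ∈ Metric.ball (0 : ℝ) (|z| + 1) → |x| ≤ |z| + 1 := fun z x hx => by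
    simpa using (mem_ball_zero_iff.1 hx).le
  have hs0 : Summable fun k => t0 k 0 := by simp [t0, summable_zero]
  have hs1 : Summable fun k => t1 k 0 := by simp [t1, summable_zero]
  have hy : ∀ z, HasDerivAt (fun x => ∑' k, t0 k x) (∑' k, t1 k z) z := fun z =>
    hasDerivAt_tsum_of_isPreconnected (hb (|z| + 1)) Metric.isOpen_ball
      (convex_ball _ _).isPreconnected (fun k x _ => hd0 k x)
      (fun k x hx => hb1 _ k x (by simp) (hle z x hx)) (hmem0 z) hs0 (hmem z)
  have hy' : ∀ z, HasDerivAt (fun x => ∑' k, t1 k x) (∑' k, t2 k z) z := fun z =>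
    hasDerivAt_tsum_of_isPreconnected (hb (|z| + 1)) Metric.isOpen_ball
      (convex_ball _ _).isPreconnected (fun k x _ => hd1 k x)
      (fun k x hx => hb2 _ k x (by simp) (hle z x hx)) (hmem0 z) hs1 (hmem z)
  have hsum0 : ∀ z, Summable fun k => t0 k z := fun z =>
    summable_of_summable_hasDerivAt_of_isPreconnected (hb (|z| + 1)) Metric.isOpen_ball
      (convex_ball _ _).isPreconnected (fun k x _ => hd0 k x)
      (fun k x hx => hb1 _ k x (by simp) (hle z x hx)) (hmem0 z) hs0 (hmem z)
  refine ⟨fun z => 1 + ∑' k, t0 k z, fun z => ∑' k, t1 k z,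
    fun z => (hy z).const_add 1, fun z => ?_, fun z hz => ⟨?_, ?_⟩⟩
  · refine (hy' z).congr_deriv (Eq.symm ?_)
    have h : Summable fun k => a k * z ^ ((N + 2) * k) := by
      rw [← summable_nat_add_iff 1]
      simpa only [t0, mul_add, mul_one] using hsum0 z
    have h2 := h.tsum_eq_zero_add
    simp only [mul_add, mul_one] at h2
    have h3 : (1 : ℝ) + ∑' k, t0 k z = ∑' k, a k * z ^ ((N + 2) * k) := by
      rw [h2]; simp [a, airyCoeff, t0]
    beta_reduce
    rw [h3, ← tsum_mul_left]
    refine tsum_congr fun k => ?_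
    simp only [t2]
    rw [pow_add]; ring
  · have : 0 ≤ ∑' k, t0 k z := tsum_nonneg fun k => mul_nonneg (ha0 _) (by positivity)
    linarith
  · exact tsum_nonneg fun k => mul_nonneg
      (div_nonneg (mul_nonneg hc (ha0 _)) (by positivity)) (by positivity)

open Set in
/-- Variation of constants and comparison with a supersolution: if `y` is a positive solution of
`y'' = q y` and `φ ≥ 0` satisfies `φ'' + |f| ≤ q φ` on `[Z, ∞)`, then `u'' = q u + f` has a
solution bounded by `φ` on `[Z, ∞)`. -/
theorem exists_solution_abs_le_supersolution {a Z : ℝ} (hZ : a < Z)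
    {q f y y' φ φ' φ'' : ℝ → ℝ} (hf : ContinuousOn f (Ioi a))
    (hy : ∀ z, a < z → HasDerivAt y (y' z) z)
    (hy' : ∀ z, a < z → HasDerivAt y' (q z * y z) z)
    (hy0 : ∀ z, a < z → 0 < y z) (hy'Z : 0 ≤ y' Z)
    (hφ : ∀ z, a < z → HasDerivAt φ (φ' z) z)
    (hφ' : ∀ z, a < z → HasDerivAt φ' (φ'' z) z)
    (hφ0 : ∀ z, Z ≤ z → 0 ≤ φ z) (hφ'Z : φ' Z ≤ 0)
    (hsuper : ∀ z, Z ≤ z → |f z| ≤ q z * φ z - φ'' z) :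
    ∃ u u' : ℝ → ℝ, (∀ z, a < z → HasDerivAt u (u' z) z) ∧
      (∀ z, a < z → HasDerivAt u' (q z * u z + f z) z) ∧ ∀ z, Z ≤ z → |u z| ≤ φ z := by
  have hyc : ContinuousOn y (Ioi a) := fun z hz => (hy z hz).continuousAt.continuousWithinAt
  obtain ⟨F, hFZ, hF⟩ := exists_primitive_Ioi (hyc.mul hf) hZ
  have hFc : ContinuousOn F (Ioi a) := fun z hz => (hF z hz).continuousAt.continuousWithinAt
  obtain ⟨w, hwZ, hw⟩ := exists_primitive_Ioi (f := fun z => F z / y z ^ 2)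
    (hFc.div (hyc.pow 2) fun z hz => (pow_pos (hy0 z hz) 2).ne') hZ
  have hP : ∀ z, a < z → HasDerivAt (fun z => φ z * y' z - φ' z * y z)
      (y z * (q z * φ z - φ'' z)) z := fun z hz => by
    refine (((hφ z hz).mul (hy' z hz)).sub ((hφ' z hz).mul (hy z hz))).congr_deriv ?_
    ring
  have hPZ : 0 ≤ φ Z * y' Z - φ' Z * y Z := by
    nlinarith [mul_nonneg (hφ0 Z le_rfl) hy'Z, mul_nonneg (neg_nonneg.2 hφ'Z) (hy0 Z hZ).le]
  have hFP : ∀ z, Z ≤ z → |F z| ≤ φ z * y' z - φ' z * y z := by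
    intro z hz
    have h1 := monotoneOn_Ici_of_hasDerivAt_nonneg (a := Z)
      (fun x hx => (hP x (hZ.trans_le hx)).add (hF x (hZ.trans_le hx)))
      (fun x hx => by
        have := neg_abs_le (f x)
        have := hsuper x hx
        have := hy0 x (hZ.trans_le hx)
        simp only [Pi.mul_apply]
        rw [← mul_add]; exact mul_nonneg this.le (by linarith)) self_mem_Ici hz hz
    have h2 := monotoneOn_Ici_of_hasDerivAt_nonneg (a := Z)
      (fun x hx => (hP x (hZ.trans_le hx)).sub (hF x (hZ.trans_le hx)))
      (fun x hx => by
        have := le_abs_self (f x)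
        have := hsuper x hx
        have := hy0 x (hZ.trans_le hx)
        simp only [Pi.mul_apply]
        rw [← mul_sub]; exact mul_nonneg this.le (by linarith)) self_mem_Ici hz hz
    simp only [Pi.add_apply, Pi.sub_apply, hFZ] at h1 h2
    exact abs_le.2 ⟨by linarith, by linarith⟩
  have hg : ∀ z, a < z → HasDerivAt (fun z => φ z / y z)
      (-(φ z * y' z - φ' z * y z) / y z ^ 2) z := fun z hz => by
    refine ((hφ z hz).div (hy z hz) (hy0 z hz).ne').congr_deriv ?_
    ring
  have hlow : MonotoneOn (fun z => w z - φ z / y z) (Ici Z) := by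
    refine monotoneOn_Ici_of_hasDerivAt_nonneg
      (fun x hx => (hw x (hZ.trans_le hx)).sub (hg x (hZ.trans_le hx))) fun x hx => ?_
    rw [← sub_div]
    exact div_nonneg (by linarith [neg_abs_le (F x), hFP x hx]) (sq_nonneg _)
  have hupp : MonotoneOn (fun z => -(w z + φ z / y z)) (Ici Z) := by
    refine monotoneOn_Ici_of_hasDerivAt_nonneg
      (fun x hx => ((hw x (hZ.trans_le hx)).add (hg x (hZ.trans_le hx))).neg) fun x hx => ?_
    rw [← add_div, ← neg_div]
    exact div_nonneg (by linarith [le_abs_self (F x), hFP x hx]) (sq_nonneg _)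
  have hg0 : ∀ z, Z ≤ z → 0 ≤ φ z / y z := fun z hz =>
    div_nonneg (hφ0 z hz) (hy0 z (hZ.trans_le hz)).le
  have hcross : ∀ x, Z ≤ x → ∀ z, Z ≤ z → w x - φ x / y x ≤ w z + φ z / y z := by
    intro x hx z hz
    rcases le_total x z with h | h
    · have := hlow hx hz h
      have := hg0 z hz
      simp only at *
      linarith
    · have := hupp hz hx h
      have := hg0 x hx
      simp only at *
      linarith
  obtain ⟨s, hs1, hs2⟩ : ∃ s, (∀ z, Z ≤ z → w z - φ z / y z ≤ s) ∧
      ∀ z, Z ≤ z → s ≤ w z + φ z / y z := by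
    refine ⟨sSup ((fun z => w z - φ z / y z) '' Ici Z), fun z hz => ?_, fun z hz => ?_⟩
    · refine le_csSup ⟨w Z + φ Z / y Z, ?_⟩ ⟨z, hz, rfl⟩
      rintro _ ⟨x, hx, rfl⟩
      exact hcross x hx Z le_rfl
    · refine csSup_le (nonempty_Ici.image _) ?_
      rintro _ ⟨x, hx, rfl⟩
      exact hcross x hx z hz
  refine ⟨fun z => y z * (w z - s), fun z => y' z * (w z - s) + F z / y z,
    fun z hz => ?_, fun z hz => ?_, fun z hz => ?_⟩
  · have := (hy0 z hz).ne'
    refine ((hy z hz).mul ((hw z hz).sub_const s)).congr_deriv ?_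
    field_simp
  · have := (hy0 z hz).ne'
    refine (((hy' z hz).mul ((hw z hz).sub_const s)).add
      ((hF z hz).div (hy z hz) this)).congr_deriv ?_
    simp only [Pi.mul_apply]
    field_simp
    ring
  · have h := hy0 z (hZ.trans_le hz)
    have h1 : |w z - s| ≤ φ z / y z :=
      abs_le.2 ⟨by linarith [hs2 z hz], by linarith [hs1 z hz]⟩
    rw [abs_mul, abs_of_pos h]
    calc y z * |w z - s| ≤ y z * (φ z / y z) := by gcongr
      _ = φ z := by field_simp

open Set in
/-- Interpolation of a first derivative between bounds on a function and its second derivative. -/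
theorem abs_deriv_le_of_abs_le {u u' u'' : ℝ → ℝ} {z h A B : ℝ} (hh : 0 < h)
    (hu : ∀ x ∈ Icc z (z + h), HasDerivAt u (u' x) x)
    (hu' : ∀ x ∈ Icc z (z + h), HasDerivAt u' (u'' x) x)
    (hA : ∀ x ∈ Icc z (z + h), |u x| ≤ A) (hB : ∀ x ∈ Icc z (z + h), |u'' x| ≤ B) :
    |u' z| ≤ 2 * A / h + B * h := by
  have hz : z ∈ Icc z (z + h) := ⟨le_rfl, by linarith⟩
  have hz' : z + h ∈ Icc z (z + h) := ⟨by linarith, le_rfl⟩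
  obtain ⟨x, hx, hxe⟩ := exists_hasDerivAt_eq_slope u u' (by linarith : z < z + h)
    (fun x hx => (hu x hx).continuousAt.continuousWithinAt)
    (fun x hx => hu x (Ioo_subset_Icc_self hx))
  have h1 : |u' x| ≤ 2 * A / h := by
    rw [hxe, add_sub_cancel_left, abs_div, abs_of_pos hh]
    gcongr
    exact (abs_sub _ _).trans (by linarith [hA z hz, hA _ hz'])
  have h2 : |u' z - u' x| ≤ B * |z - x| :=
    (convex_Icc z (z + h)).norm_image_sub_le_of_norm_hasDerivWithin_le
      (fun t ht => (hu' t ht).hasDerivWithinAt) hB (Ioo_subset_Icc_self hx) hz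
  have hB0 : 0 ≤ B := (abs_nonneg _).trans (hB z hz)
  have h3 : |z - x| ≤ h := abs_le.2 ⟨by linarith [hx.2], by linarith [hx.1]⟩
  have h4 := abs_add_le (u' x) (u' z - u' x)
  rw [add_sub_cancel] at h4
  have h5 := mul_le_mul_of_nonneg_left h3 hB0
  linarith

theorem Real.rpow_le_two_rpow_abs_mul {z t : ℝ} (m : ℝ) (hz : 0 < z) (h1 : z ≤ t)
    (h2 : t ≤ 2 * z) : t ^ m ≤ 2 ^ |m| * z ^ m := by
  rcases le_total 0 m with hm | hm
  · rw [abs_of_nonneg hm, ← Real.mul_rpow (by norm_num) hz.le]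
    exact Real.rpow_le_rpow (by linarith) h2 hm
  · calc t ^ m ≤ 1 * z ^ m := by
          rw [one_mul]; exact Real.rpow_le_rpow_of_nonpos hz h1 hm
      _ ≤ 2 ^ |m| * z ^ m := by
          gcongr
          exact Real.one_le_rpow (by norm_num) (abs_nonneg m)

open Set in
theorem contDiffOn_two_of_hasDerivAt {u u' u'' : ℝ → ℝ} {s : Set ℝ} (hs : IsOpen s)
    (hu : ∀ x ∈ s, HasDerivAt u (u' x) x) (hu' : ∀ x ∈ s, HasDerivAt u' (u'' x) x)
    (hu'' : ContinuousOn u'' s) : ContDiffOn ℝ 2 u s := by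
  have h1 : ContDiffOn ℝ (0 + 1) u' s := by
    refine (contDiffOn_succ_iff_deriv_of_isOpen hs).2
      ⟨fun x hx => (hu' x hx).differentiableAt.differentiableWithinAt, by simp, ?_⟩
    exact contDiffOn_zero.2 (hu''.congr fun x hx => (hu' x hx).deriv)
  have h2 : ContDiffOn ℝ (1 + 1) u s := by
    refine (contDiffOn_succ_iff_deriv_of_isOpen hs).2
      ⟨fun x hx => (hu x hx).differentiableAt.differentiableWithinAt, by simp, ?_⟩
    rw [zero_add] at h1
    exact h1.congr fun x hx => (hu x hx).deriv
  rwa [one_add_one_eq_two] at h2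

open Set in
/-- Solvability with bounds on the solution and its second derivative, uniformly in `lam ≥ lam1`. -/
theorem exists_solution_with_zeroth_second_order_bounds (N : ℕ) {lam1 : ℝ} (δ : ℝ)
    (hlam1 : 0 < lam1) :
    ∃ Z D₀ D₂ : ℝ, 1 < Z ∧ 0 ≤ D₀ ∧ 0 ≤ D₂ ∧ ∀ lam : ℝ, lam1 ≤ lam → ∀ C₀ : ℝ, 0 < C₀ →
      ∀ v : ℝ → ℝ, ContinuousOn v (Ioi 1) → (∀ z : ℝ, 1 < z → |v z| ≤ C₀ * z ^ δ) →
      ∃ u u' u'' : ℝ → ℝ, ContinuousOn u'' (Ioi 1) ∧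
        (∀ z, 1 < z → HasDerivAt u (u' z) z) ∧ (∀ z, 1 < z → HasDerivAt u' (u'' z) z) ∧
        (∀ z, u'' z = (N + 2) * lam * z ^ N * u z + (N + 2) * z ^ (N + 1) * v z) ∧
        (∀ z, Z ≤ z → |u z| ≤ D₀ * C₀ * z ^ (δ + 1)) ∧
        (∀ z, Z ≤ z → |u'' z| ≤ D₂ * C₀ * z ^ (δ + N + 1)) := by
  let Z : ℝ := 2 + (2 * |(δ + 1) * δ| + 4) / lam1
  let K : ℝ := max 0 (δ + 1) * Z ^ (δ + 2)
  have hZ2 : 2 ≤ Z := le_add_of_nonneg_right (by positivity)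
  have hZ0 : 0 < Z := by linarith
  have hK : 0 ≤ K := mul_nonneg (le_max_left _ _) (by positivity)
  have hZl : 2 * |(δ + 1) * δ| + 4 ≤ lam1 * Z := by
    have : lam1 * Z = lam1 * 2 + (2 * |(δ + 1) * δ| + 4) := by simp only [Z]; field_simp
    linarith
  refine ⟨Z, 2 * (1 + K) / lam1, (N + 2) * (2 * (1 + K) + 1), by linarith, by positivity,
    by positivity, fun lam hlam C₀ hC₀ v hv hvb => ?_⟩
  have hlam0 : 0 < lam := hlam1.trans_le hlam
  let A : ℝ := 2 * C₀ / lam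
  have hA : 0 < A := by positivity
  have hAl : A * lam = 2 * C₀ := by simp only [A]; field_simp
  obtain ⟨y, y', hy, hy', hy0⟩ :=
    exists_pos_monotone_solution (c := (N + 2) * lam) (by positivity) N
  have hpow1 : ∀ z : ℝ, 0 < z → z ^ (δ + 1) = z ^ δ * z := fun z hz => Real.rpow_add_one hz.ne' δ
  have hpow2 : ∀ z : ℝ, 0 < z → z ^ (δ + 1 - 1 - 1) = z ^ δ / z := fun z hz => by
    rw [add_sub_cancel_right, Real.rpow_sub_one hz.ne']
  have hpow3 : ∀ z : ℝ, 0 < z → z ^ (-1 - 1 - 1 : ℝ) = z⁻¹ ^ 3 := fun z hz => by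
    rw [Real.rpow_sub_one hz.ne', Real.rpow_sub_one hz.ne', Real.rpow_neg_one]; field_simp
  have hbar : ∀ z : ℝ, 1 < z →
      A * (z ^ (δ + 1) + K * z ^ (-1 : ℝ)) ≤ A * (1 + K) * z ^ (δ + 1) := by
    intro z hz
    have : K * z ^ (-1 : ℝ) ≤ K * z ^ (δ + 1) := by
      rcases le_total (δ + 1) 0 with h | h
      · simp [K, max_eq_left h]
      · gcongr
        · exact hz.le
        · linarith
    rw [mul_assoc A]
    exact mul_le_mul_of_nonneg_left (by linarith) hA.le
  have hrpow : ∀ p z : ℝ, 1 < z → HasDerivAt (fun z => z ^ p) (p * z ^ (p - 1)) z :=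
    fun p z hz => Real.hasDerivAt_rpow_const (Or.inl (by linarith))
  obtain ⟨u, u', hu, hu', hub⟩ := exists_solution_abs_le_supersolution
    (a := 1) (Z := Z) (by linarith)
    (q := fun z => (N + 2) * lam * z ^ N) (f := fun z => (N + 2) * z ^ (N + 1) * v z)
    (φ := fun z => A * (z ^ (δ + 1) + K * z ^ (-1 : ℝ)))
    (φ' := fun z => A * ((δ + 1) * z ^ (δ + 1 - 1) + K * (-1 * z ^ (-1 - 1 : ℝ))))
    (φ'' := fun z => A * ((δ + 1) * ((δ + 1 - 1) * z ^ (δ + 1 - 1 - 1)) +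
      K * (-1 * ((-1 - 1) * z ^ (-1 - 1 - 1 : ℝ)))))
    (ContinuousOn.mul (by fun_prop) hv) (fun z _ => hy z) (fun z _ => hy' z)
    (fun z hz => (hy0 z (by linarith)).1) (hy0 Z hZ0.le).2
    (fun z hz => ((hrpow _ z hz).add ((hrpow _ z hz).const_mul K)).const_mul A)
    (fun z hz => (((hrpow _ z hz).const_mul _).add
      (((hrpow _ z hz).const_mul _).const_mul K)).const_mul A)
    (fun z hz => by have : 0 < z := by linarith
                    positivity)
    (by
      have h1 : Z ^ (δ + 2) * Z ^ (-1 - 1 : ℝ) = Z ^ (δ + 1 - 1) := by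
        rw [← Real.rpow_add hZ0]; congr 1; ring
      have h2 : K * (-1 * Z ^ (-1 - 1 : ℝ)) = -(max 0 (δ + 1) * Z ^ (δ + 1 - 1)) := by
        rw [← h1]; simp only [K]; ring
      rw [h2]
      have h3 : (δ + 1) * Z ^ (δ + 1 - 1) ≤ max 0 (δ + 1) * Z ^ (δ + 1 - 1) := by
        gcongr; exact le_max_right _ _
      exact mul_nonpos_of_nonneg_of_nonpos hA.le (by linarith))
    (fun z hz => by
      have hz0 : 0 < z := by linarith
      have hz1 : 1 < z := by linarith
      rw [hpow1 z hz0, hpow2 z hz0, hpow3 z hz0, Real.rpow_neg_one, add_sub_cancel_right]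
      have hX : 0 < z ^ δ := by positivity
      generalize hXe : z ^ δ = X at hX
      have hf : |(N + 2) * z ^ (N + 1) * v z| ≤ (N + 2) * z ^ (N + 1) * (C₀ * X) := by
        rw [abs_mul, abs_of_nonneg (by positivity), ← hXe]
        gcongr
        exact hvb z hz1
      have hq : 2 * |(δ + 1) * δ| + 4 ≤ (N + 2) * lam * z ^ (N + 2) := by
        have h1 : z ≤ z ^ (N + 2) := le_self_pow₀ hz1.le (by omega)
        have h2 : lam1 * Z ≤ lam * z ^ (N + 2) :=
          mul_le_mul hlam (hz.trans h1) hZ0.le hlam0.le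
        have h3 : 0 ≤ (N + 1) * (lam * z ^ (N + 2)) := by positivity
        linarith
      have hm : (δ + 1) * δ ≤ (N + 2) * lam * z ^ (N + 2) / 2 := by
        linarith [le_abs_self ((δ + 1) * δ)]
      have h2 : 2 ≤ (N + 2) * lam * z ^ (N + 2) / 2 := by
        linarith [abs_nonneg ((δ + 1) * δ)]
      have e1 : (δ + 1) * δ * (X / z) ≤ (N + 2) * lam * z ^ N / 2 * (X * z) := by
        calc _ ≤ (N + 2) * lam * z ^ (N + 2) / 2 * (X / z) := by gcongr
          _ = _ := by rw [pow_add]; field_simp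
      have e2 : K * (2 * z⁻¹ ^ 3) ≤ (N + 2) * lam * z ^ N / 2 * (K * z⁻¹) := by
        calc _ ≤ K * ((N + 2) * lam * z ^ (N + 2) / 2 * z⁻¹ ^ 3) := by gcongr
          _ = _ := by rw [pow_add]; field_simp
      have e3 := mul_le_mul_of_nonneg_left (add_le_add e1 e2) hA.le
      have e4 : (N + 2) * z ^ (N + 1) * (C₀ * X) =
          A * ((N + 2) * lam * z ^ N / 2 * (X * z)) := by
        have : C₀ = A * lam / 2 := by linarith
        rw [this]; ring
      have e5 : 0 ≤ A * ((N + 2) * lam * z ^ N / 2 * (K * z⁻¹)) := by positivity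
      nlinarith [e3, e4, e5, hf])
  have hub' : ∀ z, Z ≤ z → |u z| ≤ A * (1 + K) * z ^ (δ + 1) := fun z hz =>
    (hub z hz).trans (hbar z (by linarith))
  refine ⟨u, u', fun z => (N + 2) * lam * z ^ N * u z + (N + 2) * z ^ (N + 1) * v z, ?_,
    hu, hu', fun z => rfl, fun z hz => ?_, fun z hz => ?_⟩
  · have huc : ContinuousOn u (Ioi 1) := fun z hz => (hu z hz).continuousAt.continuousWithinAt
    exact (ContinuousOn.mul (by fun_prop) huc).add (ContinuousOn.mul (by fun_prop) hv)
  · have hz0 : 0 < z := by linarith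
    refine (hub' z hz).trans ?_
    refine mul_le_mul_of_nonneg_right ?_ (by positivity)
    calc A * (1 + K) = 2 * (1 + K) / lam * C₀ := by simp only [A]; ring
      _ ≤ 2 * (1 + K) / lam1 * C₀ := by gcongr
  · have hz0 : 0 < z := by linarith
    have h1 := hub' z hz
    have h2 := hvb z (by linarith)
    have hp : z ^ (δ + N + 1) = z ^ δ * z ^ (N + 1) := by
      rw [add_assoc, Real.rpow_add hz0, ← Nat.cast_add_one, Real.rpow_natCast]
    rw [hpow1 z hz0] at h1
    rw [hp]
    refine (abs_add_le _ _).trans ?_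
    rw [abs_mul, abs_mul _ (v z), abs_of_nonneg (a := (N + 2) * lam * z ^ N) (by positivity),
      abs_of_nonneg (a := (N + 2) * z ^ (N + 1)) (by positivity)]
    calc _ ≤ (N + 2) * lam * z ^ N * (A * (1 + K) * (z ^ δ * z)) +
          (N + 2) * z ^ (N + 1) * (C₀ * z ^ δ) := by gcongr
      _ = (N + 2) * (A * lam * (1 + K) + C₀) * (z ^ δ * z ^ (N + 1)) := by ring
      _ = _ := by rw [hAl]; ring

/-- Solvability with estimates for the zero-mode ODE `u'' = n·λ·z^{n−2}·u + n·z^{n−1}·v`: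
for `n ≥ 3`, `λ₁ > 0`, `δ ∈ ℝ` there is `C > 1` (depending only on `n`, `λ₁`, `δ`) such that
for every `λ ≥ λ₁`, `C₀ > 0` and continuous `v` on `(1,∞)` with `|v(z)| ≤ C₀·z^δ`, there is a
`C²` solution `u` with `|u(z)| ≤ C·C₀·z^{δ+1}`, `|u'(z)| ≤ C·C₀·z^{δ+n/2}` and
`|u''(z)| ≤ C·C₀·z^{δ+n−1}` for `z > C`. -/
theorem zero_mode_ODE_solution (n : ℕ) (hn : 3 ≤ n) (lam1 δ : ℝ) (hlam1 : 0 < lam1) :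
    ∃ C : ℝ, 1 < C ∧ ∀ lam : ℝ, lam1 ≤ lam → ∀ C₀ : ℝ, 0 < C₀ → ∀ v : ℝ → ℝ,
      ContinuousOn v (Set.Ioi 1) → (∀ z : ℝ, 1 < z → |v z| ≤ C₀ * z ^ δ) →
      ∃ u : ℝ → ℝ, ContDiffOn ℝ 2 u (Set.Ioi 1) ∧
        (∀ z : ℝ, 1 < z →
          deriv (deriv u) z = n * lam * z ^ ((n : ℝ) - 2) * u z + n * z ^ ((n : ℝ) - 1) * v z) ∧
        (∀ z : ℝ, C < z →
          |u z| ≤ C * C₀ * z ^ (δ + 1) ∧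
          |deriv u z| ≤ C * C₀ * z ^ (δ + (n : ℝ) / 2) ∧
          |deriv (deriv u) z| ≤ C * C₀ * z ^ (δ + (n : ℝ) - 1)) := by
  obtain ⟨N, rfl⟩ : ∃ N, n = N + 2 := ⟨n - 2, by omega⟩
  have hcast : ((N + 2 : ℕ) : ℝ) = N + 2 := by push_cast; ring
  rw [hcast]
  obtain ⟨Z, D₀, D₂, hZ, hD₀, hD₂, H⟩ :=
    exists_solution_with_zeroth_second_order_bounds N δ hlam1
  let D₁ : ℝ := 2 * D₀ * 2 ^ |δ + 1| + D₂ * 2 ^ |δ + N + 1|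
  have hD₁ : 0 ≤ D₁ := by positivity
  refine ⟨Z + D₀ + D₁ + D₂, by linarith, fun lam hlam C₀ hC₀ v hv hvb => ?_⟩
  obtain ⟨u, u', u'', hcont, hu, hu', hode, hb0, hb2⟩ := H lam hlam C₀ hC₀ v hv hvb
  have hd : ∀ z, 1 < z → deriv u z = u' z := fun z hz => (hu z hz).deriv
  have hdd : ∀ z, 1 < z → deriv (deriv u) z = u'' z := fun z hz => by
    rw [Filter.EventuallyEq.deriv_eq (f := u') ?_, (hu' z hz).deriv]
    filter_upwards [Ioi_mem_nhds hz] with x hx using hd x hx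
  refine ⟨u, contDiffOn_two_of_hasDerivAt isOpen_Ioi hu hu' hcont, fun z hz => ?_, fun z hz => ?_⟩
  · rw [hdd z hz, hode, add_sub_cancel_right, Real.rpow_natCast,
      show (N : ℝ) + 2 - 1 = (N + 1 : ℕ) by push_cast; ring, Real.rpow_natCast]
  have hzZ : Z ≤ z := by linarith
  have hz1 : 1 < z := by linarith
  have hz0 : 0 < z := by linarith
  rw [hd z hz1, hdd z hz1, show δ + ((N : ℝ) + 2) - 1 = δ + N + 1 by ring]
  refine ⟨(hb0 z hzZ).trans ?_, ?_, (hb2 z hzZ).trans ?_⟩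
  · gcongr
    linarith
  · have hh : 0 < z ^ (-(N / 2 : ℝ)) := by positivity
    have hh1 : z ^ (-(N / 2 : ℝ)) ≤ 1 :=
      Real.rpow_le_one_of_one_le_of_nonpos hz1.le (neg_nonpos.2 (by positivity))
    have hI := abs_deriv_le_of_abs_le (z := z) hh
      (fun x hx => hu x (hz1.trans_le hx.1)) (fun x hx => hu' x (hz1.trans_le hx.1))
      (A := D₀ * C₀ * (2 ^ |δ + 1| * z ^ (δ + 1)))
      (B := D₂ * C₀ * (2 ^ |δ + N + 1| * z ^ (δ + N + 1)))
      (fun x hx => (hb0 x (hzZ.trans hx.1)).trans (by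
        gcongr
        exact Real.rpow_le_two_rpow_abs_mul _ hz0 hx.1 (by linarith [hx.2])))
      (fun x hx => (hb2 x (hzZ.trans hx.1)).trans (by
        gcongr
        exact Real.rpow_le_two_rpow_abs_mul _ hz0 hx.1 (by linarith [hx.2])))
    have e1 : z ^ (δ + 1) = z ^ (δ + ((N : ℝ) + 2) / 2) * z ^ (-(N / 2 : ℝ)) := by
      rw [← Real.rpow_add hz0]; congr 1; ring
    have e2 : z ^ (δ + N + 1) * z ^ (-(N / 2 : ℝ)) = z ^ (δ + ((N : ℝ) + 2) / 2) := by
      rw [← Real.rpow_add hz0]; congr 1; ring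
    calc |u' z| ≤ _ := hI
      _ = 2 * D₀ * C₀ * 2 ^ |δ + 1| * z ^ (δ + ((N : ℝ) + 2) / 2) +
          D₂ * C₀ * 2 ^ |δ + N + 1| * (z ^ (δ + N + 1) * z ^ (-(N / 2 : ℝ))) := by
        rw [e1]; field_simp
      _ = D₁ * C₀ * z ^ (δ + ((N : ℝ) + 2) / 2) := by rw [e2]; simp only [D₁]; ring
      _ ≤ _ := by
        gcongr
        linarith
  · gcongr
    linarith
end

section
/- Let n ≥ 3 be an integer, set α = 1 − 1/n, and let β ≤ 0 with Q := α − β − 1 satisfying Q ≤ 1. There exists a constant C > 1, depending only on n, such that for all y ≤ −1: C^{-1} · e^{y} · (−y)^{β−α} ≤ Ψ♭(β, α, y) ≤ e^{y} · (−y)^{β−α}. -/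
/-- `Ψ♭(β, α, y) = (e^y/Γ(α−β)) · ∫_0^∞ e^{y·s} · s^{α−β−1} · (1+s)^{β−1} ds`. -/
noncomputable def PsiFlat (β α y : ℝ) : ℝ :=
  (Real.exp y / Real.Gamma (α - β)) *
    ∫ s in Set.Ioi (0:ℝ), Real.exp (y * s) * s ^ (α - β - 1) * (1 + s) ^ (β - 1)

open MeasureTheory Set in
theorem integrableOn_rpow_mul_exp_neg_mul_Ioi {a r : ℝ} (ha : 0 < a) (hr : 0 < r) :
    IntegrableOn (fun s : ℝ => s ^ (a - 1) * Real.exp (-(r * s))) (Ioi 0) := by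
  apply Integrable.of_integral_ne_zero
  rw [Real.integral_rpow_mul_exp_neg_mul_Ioi ha hr]
  have := Real.Gamma_pos_of_pos ha
  positivity

open MeasureTheory Set in
theorem integrableOn_rpow_mul_exp_neg_mul_one_add_rpow {a r b : ℝ} (ha : 0 < a) (hr : 0 < r)
    (hb : b ≤ 0) :
    IntegrableOn (fun s : ℝ => s ^ (a - 1) * Real.exp (-(r * s)) * (1 + s) ^ b) (Ioi 0) := by
  refine (integrableOn_rpow_mul_exp_neg_mul_Ioi ha hr).mono'
    (Measurable.aestronglyMeasurable (by fun_prop)) ?_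
  filter_upwards [ae_restrict_mem measurableSet_Ioi] with s hs
  have hs : 0 < s := hs
  rw [Real.norm_of_nonneg (by positivity)]
  exact mul_le_of_le_one_right (by positivity) (Real.rpow_le_one_of_one_le_of_nonpos (by linarith) hb)

open MeasureTheory Set in
theorem setIntegral_rpow_mul_exp_neg_mul_one_add_rpow_le {a r b : ℝ} (ha : 0 < a) (hr : 0 < r)
    (hb : b ≤ 0) :
    ∫ s in Ioi (0 : ℝ), s ^ (a - 1) * Real.exp (-(r * s)) * (1 + s) ^ b ≤
      (1 / r) ^ a * Real.Gamma a := by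
  rw [← Real.integral_rpow_mul_exp_neg_mul_Ioi ha hr]
  refine setIntegral_mono_on (integrableOn_rpow_mul_exp_neg_mul_one_add_rpow ha hr hb)
    (integrableOn_rpow_mul_exp_neg_mul_Ioi ha hr) measurableSet_Ioi fun s (hs : 0 < s) => ?_
  exact mul_le_of_le_one_right (by positivity) (Real.rpow_le_one_of_one_le_of_nonpos (by linarith) hb)

open MeasureTheory Set in
theorem le_setIntegral_rpow_mul_exp_neg_mul_one_add_rpow {a r b : ℝ} (ha : 0 < a) (hr : 0 < r)
    (hb : b ≤ 0) :
    (1 / (r - b)) ^ a * Real.Gamma a ≤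
      ∫ s in Ioi (0 : ℝ), s ^ (a - 1) * Real.exp (-(r * s)) * (1 + s) ^ b := by
  have hrb : 0 < r - b := by linarith
  rw [← Real.integral_rpow_mul_exp_neg_mul_Ioi ha hrb]
  refine setIntegral_mono_on (integrableOn_rpow_mul_exp_neg_mul_Ioi ha hrb)
    (integrableOn_rpow_mul_exp_neg_mul_one_add_rpow ha hr hb) measurableSet_Ioi
    fun s (hs : 0 < s) => ?_
  have hlog : Real.log (1 + s) ≤ s := by linarith [Real.log_le_sub_one_of_pos (x := 1 + s) (by linarith)]
  rw [mul_assoc, Real.rpow_def_of_pos (show 0 < 1 + s by linarith), ← Real.exp_add]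
  gcongr
  nlinarith

/-- For an integer `n ≥ 3`, `α = 1 − 1/n`, there is a constant `C > 1` depending only on `n`
such that for every `β ≤ 0` with `Q := α − β − 1 ≤ 1` and every `y ≤ −1`:
`C⁻¹ · e^y · (−y)^{β−α} ≤ Ψ♭(β, α, y) ≤ e^y · (−y)^{β−α}`. -/
theorem PsiFlat_bounds_small_Q (n : ℕ) (hn : 3 ≤ n) :
    ∃ C : ℝ, 1 < C ∧ ∀ β : ℝ, β ≤ 0 →
      (1 - 1 / (n : ℝ)) - β - 1 ≤ 1 → ∀ y : ℝ, y ≤ -1 →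
        C⁻¹ * Real.exp y * (-y) ^ (β - (1 - 1 / (n : ℝ))) ≤ PsiFlat β (1 - 1 / (n : ℝ)) y ∧
        PsiFlat β (1 - 1 / (n : ℝ)) y ≤ Real.exp y * (-y) ^ (β - (1 - 1 / (n : ℝ))) := by
  refine ⟨16, by norm_num, fun β hβ hQ y hy => ?_⟩
  have hα : 0 < 1 - 1 / (n : ℝ) := by
    rw [sub_pos, div_lt_one (by positivity)]
    exact_mod_cast (by omega : 1 < n)
  generalize 1 - 1 / (n : ℝ) = α at *
  obtain ⟨a, rfl⟩ : ∃ a, α = a + β := ⟨α - β, by ring⟩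
  obtain ⟨r, rfl⟩ : ∃ r, y = -r := ⟨-y, by ring⟩
  have ha : 0 < a := by linarith
  have hr : 0 < r := by linarith
  have hΓ := Real.Gamma_pos_of_pos ha
  have hpow : (1 / r) ^ a = r ^ (-a) := by
    rw [one_div, Real.inv_rpow hr.le, Real.rpow_neg hr.le]
  have hint : ∫ s in Set.Ioi (0 : ℝ), Real.exp (-r * s) * s ^ (a - 1) * (1 + s) ^ (β - 1) =
      ∫ s in Set.Ioi (0 : ℝ), s ^ (a - 1) * Real.exp (-(r * s)) * (1 + s) ^ (β - 1) := by
    simp only [neg_mul, mul_comm (Real.exp _)]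
  have hupper := setIntegral_rpow_mul_exp_neg_mul_one_add_rpow_le ha hr (b := β - 1) (by linarith)
  have hlower := le_setIntegral_rpow_mul_exp_neg_mul_one_add_rpow ha hr (b := β - 1) (by linarith)
  have hscale : (16 : ℝ)⁻¹ * r ^ (-a) ≤ (1 / (r - (β - 1))) ^ a := by
    calc (16 : ℝ)⁻¹ * r ^ (-a) = (4⁻¹ : ℝ) ^ (2 : ℝ) * (1 / r) ^ a := by
          rw [hpow]; norm_num
      _ ≤ (4⁻¹ : ℝ) ^ a * (1 / r) ^ a := by
          gcongr ?_ * _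
          exact Real.rpow_le_rpow_of_exponent_ge (by norm_num) (by norm_num) (by linarith)
      _ = (1 / (4 * r)) ^ a := by
          rw [← Real.mul_rpow (by norm_num) (by positivity)]
          congr 1
          field_simp
      _ ≤ (1 / (r - (β - 1))) ^ a := by
          gcongr <;> linarith
  rw [PsiFlat, add_sub_cancel_right, hint, neg_neg, show β - (a + β) = -a by ring]
  rw [hpow] at hupper
  constructor
  · rw [mul_right_comm, mul_comm, div_mul_eq_mul_div, le_div_iff₀ hΓ, mul_assoc]
    gcongr
    exact (mul_le_mul_of_nonneg_right hscale hΓ.le).trans hlower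
  · rw [div_mul_eq_mul_div, div_le_iff₀ hΓ, mul_assoc]
    gcongr
end
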